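/- Let b ∈ k with b^{p²} ≠ b. Then F(M_b) + V(M_b) = V(N), the W-span of p e₁, p e₃, e₂, e₄; in particular the quotient M_b/(F(M_b) + V(M_b)) is a 1-dimensional k-vector space, i.e. the Dieudonné module M_b has a-number 1. -/

import Mathlib

/-!
Common setup: `p` a prime, `k` an algebraically closed field of characteristic `p`,
`W = W(k)` the ring of `p`-typical Witt vectors, `σ` the Witt vector Frobenius,
`ρ : W → k` reduction (0-th coefficient), `N = W⁴` with the semilinear maps `F`, `V`,
the Gram matrix `J'` of the alternating form, the Dieudonné submodules `M_b`, and the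
coordinate map `q` for `N/V(N)`.
-/

noncomputable section

open WittVector Matrix

variable (p : ℕ) [Fact p.Prime] (k : Type) [Field k] [IsAlgClosed k] [CharP k p]

/-- The reduction map `ρ : W(k) → k` sending a Witt vector to its 0-th coefficient. -/
def redW : WittVector p k →+* k where
  toFun x := x.coeff 0
  map_one' := WittVector.one_coeff_zero p k
  map_mul' := WittVector.mul_coeff_zero
  map_zero' := WittVector.zero_coeff p k 0
  map_add' := WittVector.add_coeff_zero

/-- The Witt vector Frobenius `σ`, a ring automorphism of `W(k)` since `k` is perfect. -/
def sigmaW : WittVector p k ≃+* WittVector p k := WittVector.frobeniusEquiv p k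

/-- The standard basis vectors `e₁, e₂, e₃, e₄` of `N = W⁴` (0-indexed). -/
def eW (i : Fin 4) : Fin 4 → WittVector p k := Pi.single i 1

/-- The `σ`-semilinear map `F : N → N` with `F e₁ = e₂`, `F e₂ = -p e₁`,
`F e₃ = e₄`, `F e₄ = -p e₃`. -/
def Fmap : (Fin 4 → WittVector p k) → (Fin 4 → WittVector p k) := fun x =>
  ![-(p : WittVector p k) * sigmaW p k (x 1), sigmaW p k (x 0),
    -(p : WittVector p k) * sigmaW p k (x 3), sigmaW p k (x 2)]

/-- The `σ⁻¹`-semilinear map `V : N → N` with `V e₁ = -e₂`, `V e₂ = p e₁`,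
`V e₃ = -e₄`, `V e₄ = p e₃`. -/
def Vmap : (Fin 4 → WittVector p k) → (Fin 4 → WittVector p k) := fun x =>
  ![(p : WittVector p k) * (sigmaW p k).symm (x 1), -(sigmaW p k).symm (x 0),
    (p : WittVector p k) * (sigmaW p k).symm (x 3), -(sigmaW p k).symm (x 2)]

/-- The Gram matrix `J'` of the alternating form `⟨ , ⟩` on `N` with
`⟨e₁,e₃⟩ = 1 = -⟨e₃,e₁⟩`, `⟨e₂,e₄⟩ = p = -⟨e₄,e₂⟩`. -/
def Jmat : Matrix (Fin 4) (Fin 4) (WittVector p k) :=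
  !![0, 0, 1, 0;
     0, 0, 0, (p : WittVector p k);
     -1, 0, 0, 0;
     0, -(p : WittVector p k), 0, 0]

/-- The `W`-linear endomorphism of `N` with matrix `A` commutes with `F`. -/
def CommF (A : Matrix (Fin 4) (Fin 4) (WittVector p k)) : Prop :=
  ∀ x, A.mulVec (Fmap p k x) = Fmap p k (A.mulVec x)

/-- The `W`-submodule `M_b` of `N` spanned by `p e₁, p e₃, e₂, e₄` and `e₁ + b̃ e₃`,
where `b̃` is the Teichmüller lift of `b` (a lift of `b` under `ρ`). -/
def Mmod (b : k) : Submodule (WittVector p k) (Fin 4 → WittVector p k) :=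
  Submodule.span (WittVector p k)
    {(p : WittVector p k) • eW p k 0, (p : WittVector p k) • eW p k 2, eW p k 1, eW p k 3,
     eW p k 0 + WittVector.teichmuller p b • eW p k 2}

/-- Coordinates of the class of `x ∈ N` in `N/V(N) ≃ k²` with respect to the basis given
by the classes of `e₁` and `e₃`. -/
def qmap : (Fin 4 → WittVector p k) → (Fin 2 → k) := fun x => ![redW p k (x 0), redW p k (x 2)]

theorem redW_sigmaW (x : WittVector p k) : redW p k (sigmaW p k x) = redW p k x ^ p :=
  WittVector.coeff_frobenius_charP p x 0

theorem redW_sigmaW_symm_pow (x : WittVector p k) :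
    redW p k ((sigmaW p k).symm x) ^ p = redW p k x := by
  rw [← redW_sigmaW, RingEquiv.apply_symm_apply]

theorem redW_teichmuller (b : k) : redW p k (WittVector.teichmuller p b) = b :=
  WittVector.teichmuller_coeff_zero p b

theorem redW_eq_zero_iff (x : WittVector p k) : redW p k x = 0 ↔ (p : WittVector p k) ∣ x := by
  rw [← Ideal.mem_span_singleton]
  exact (WittVector.mem_span_p_iff_coeff_zero_eq_zero x).symm

/-- `M_b` is the preimage under `q` of the line spanned by `(1, b)`. -/
theorem mem_Mmod_iff (b : k) (x : Fin 4 → WittVector p k) :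
    x ∈ Mmod p k b ↔ redW p k (x 2) = b * redW p k (x 0) := by
  simp only [Mmod, Submodule.mem_span_insert, Submodule.mem_span_singleton]
  constructor
  · rintro ⟨a₀, _, ⟨a₂, _, ⟨a₁, _, ⟨a₃, _, ⟨c, rfl⟩, rfl⟩, rfl⟩, rfl⟩, rfl⟩
    simp [eW, redW_teichmuller, mul_comm]
  · intro h
    have h' : redW p k (x 2 - WittVector.teichmuller p b * x 0) = 0 := by
      rw [map_sub, map_mul, redW_teichmuller, h, sub_self]
    obtain ⟨u, hu⟩ := (redW_eq_zero_iff p k _).1 h'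
    refine ⟨0, _, ⟨u, _, ⟨x 1, _, ⟨x 3, _, ⟨x 0, rfl⟩, rfl⟩, rfl⟩, rfl⟩, ?_⟩
    funext i
    fin_cases i <;> simp [eW]
    linear_combination hu

theorem mem_span_image_V_iff (z : Fin 4 → WittVector p k) :
    z ∈ Submodule.span (WittVector p k)
        {(p : WittVector p k) • eW p k 0, eW p k 1, (p : WittVector p k) • eW p k 2, eW p k 3} ↔
      (p : WittVector p k) ∣ z 0 ∧ (p : WittVector p k) ∣ z 2 := by
  simp only [Submodule.mem_span_insert, Submodule.mem_span_singleton]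
  constructor
  · rintro ⟨a₀, _, ⟨a₁, _, ⟨a₂, _, ⟨a₃, rfl⟩, rfl⟩, rfl⟩, rfl⟩
    simp [eW]
  · rintro ⟨⟨a, ha⟩, ⟨c, hc⟩⟩
    refine ⟨a, _, ⟨z 1, _, ⟨c, _, ⟨z 3, rfl⟩, rfl⟩, rfl⟩, ?_⟩
    funext i
    fin_cases i <;> simp [eW, ha, hc, mul_comm]

/-- If `b ∉ 𝔽_{p²}`, the components of `F + V` along `e₂` and `e₄` take arbitrary values
on `M_b × M_b`. -/
theorem exists_sigmaW_sub_eq (b : k) (hb : b ^ p ^ 2 ≠ b) (z₁ z₃ : WittVector p k) :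
    ∃ s s' t t' : WittVector p k,
      redW p k s' = b * redW p k s ∧ redW p k t' = b * redW p k t ∧
      sigmaW p k s - (sigmaW p k).symm t = z₁ ∧ sigmaW p k s' - (sigmaW p k).symm t' = z₃ := by
  obtain ⟨β, rfl⟩ := IsAlgClosed.exists_pow_nat_eq b (Fact.out : p.Prime).pos
  have hβ : β - (β ^ p) ^ p ≠ 0 := by
    intro h
    apply hb
    rw [sq, pow_mul, ← sub_eq_zero.1 h]
  -- `r` is the reduction of `σ⁻¹ t`
  set r : k := ((β ^ p) ^ p * redW p k z₁ - redW p k z₃) / (β - (β ^ p) ^ p) with hr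
  have hr' : redW p k z₃ + β * r = (β ^ p) ^ p * (redW p k z₁ + r) := by
    have := div_mul_cancel₀ ((β ^ p) ^ p * redW p k z₁ - redW p k z₃) hβ
    rw [← hr] at this
    linear_combination this
  set T : WittVector p k := WittVector.teichmuller p r
  set B : WittVector p k := WittVector.teichmuller p β
  refine ⟨(sigmaW p k).symm (z₁ + T), (sigmaW p k).symm (z₃ + B * T), sigmaW p k T,
    sigmaW p k (B * T), ?_, ?_, by simp, by simp⟩
  · apply frobenius_inj k p
    simp only [frobenius_def, redW_sigmaW_symm_pow, map_add, map_mul, T, B,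
      redW_teichmuller, hr']
  · simp only [redW_sigmaW, map_mul, T, B, redW_teichmuller]

/-- for `b ∉ 𝔽_{p²}`, `F(M_b) + V(M_b) = V(N)` (the `W`-span of
`p e₁, e₂, p e₃, e₄`); in particular `M_b/(F(M_b) + V(M_b))` is 1-dimensional over `k`,
i.e. `M_b` has `a`-number 1. -/
theorem a_number_one
    (b : k) (hb : b ^ p ^ 2 ≠ b) :
    {z : Fin 4 → WittVector p k |
        ∃ x ∈ Mmod p k b, ∃ y ∈ Mmod p k b, z = Fmap p k x + Vmap p k y} =
      ((Submodule.span (WittVector p k)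
        {(p : WittVector p k) • eW p k 0, eW p k 1, (p : WittVector p k) • eW p k 2,
          eW p k 3} : Submodule (WittVector p k) (Fin 4 → WittVector p k)) :
        Set (Fin 4 → WittVector p k)) ∧
    ∃ w : Fin 2 → k, w ≠ 0 ∧
      qmap p k '' (Mmod p k b : Set (Fin 4 → WittVector p k)) =
        Set.range fun c : k => c • w := by
  constructor
  · ext z
    rw [SetLike.mem_coe, mem_span_image_V_iff]
    constructor
    · rintro ⟨x, -, y, -, rfl⟩
      constructor <;> simp [Fmap, Vmap, dvd_add, dvd_mul_right]
    · rintro ⟨⟨a, ha⟩, ⟨c, hc⟩⟩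
      obtain ⟨s, s', t, t', hs, ht, h₁, h₃⟩ := exists_sigmaW_sub_eq p k b hb (z 1) (z 3)
      refine ⟨![s, 0, s', 0], (mem_Mmod_iff p k b _).2 hs,
        ![t, sigmaW p k a, t', sigmaW p k c], (mem_Mmod_iff p k b _).2 ht, ?_⟩
      funext i
      fin_cases i <;> simp [Fmap, Vmap, ha, hc, ← h₁, ← h₃, sub_eq_add_neg]
  · refine ⟨![1, b], fun h => one_ne_zero (congrFun h 0), ?_⟩
    ext v
    simp only [Set.mem_image, Set.mem_range, SetLike.mem_coe, mem_Mmod_iff]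
    constructor
    · rintro ⟨x, hx, rfl⟩
      refine ⟨redW p k (x 0), ?_⟩
      funext i
      fin_cases i <;> simp [qmap, hx, mul_comm]
    · rintro ⟨c, rfl⟩
      refine ⟨![WittVector.teichmuller p c, 0, WittVector.teichmuller p (b * c), 0], ?_, ?_⟩
      · simp [redW_teichmuller, -map_mul]
      · funext i
        fin_cases i <;> simp [qmap, redW_teichmuller, mul_comm, -map_mul]

end
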